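/- For every s > 0 one has ∫₀^∞ f(u)/(s+u) du = e^{−η(s)}; that is, (1/π)·∫₀^∞ (u·e^{η(u)})/((1+u²)·(s+u)) du = e^{−η(s)}. Moreover ∫₀^∞ f(u)/u du = 1, i.e. (1/π)·∫₀^∞ e^{η(u)}/(1+u²) du = 1. -/

import Mathlib

open Real MeasureTheory Set

/-- `η t = (1/4)·log(1+t²) − (1/π)·∫₀^t log|s|/(1+s²) ds`. -/
noncomputable def etaF (t : ℝ) : ℝ :=
  Real.log (1 + t ^ 2) / 4 - (1 / Real.pi) * ∫ s in (0 : ℝ)..t, Real.log |s| / (1 + s ^ 2)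

/-- The first-exit-time density profile `f(s) = (1/π)·(s/(1+s²))·e^{η(s)}`. -/
noncomputable def fexit (s : ℝ) : ℝ :=
  (1 / Real.pi) * (s / (1 + s ^ 2)) * Real.exp (etaF s)

lemma dslope_cexp_ne_zero {c ζ : ℂ} (h : |ζ.im - c.im| < 2 * π) :
    dslope Complex.exp c ζ ≠ 0 := by
  rcases eq_or_ne ζ c with rfl | hne
  · simp [dslope_same]
  · rw [dslope_of_ne _ hne, slope_def_field]
    refine div_ne_zero (fun h0 => hne ?_) (sub_ne_zero.2 hne)
    obtain ⟨n, hn⟩ := Complex.exp_eq_exp_iff_exists_int.1 (sub_eq_zero.1 h0)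
    have him : ζ.im - c.im = n * (2 * π) := by rw [hn]; simp
    rw [him, abs_mul, abs_of_pos Real.two_pi_pos] at h
    have h1 : |(n : ℝ)| < 1 := by
      by_contra! hc
      nlinarith [Real.two_pi_pos]
    have h2 : n = 0 := Int.abs_lt_one_iff.1 (by exact_mod_cast h1)
    simpa [h2] using hn

lemma differentiable_dslope_cexp (c : ℂ) : Differentiable ℂ (dslope Complex.exp c) :=
  differentiableOn_univ.1 <| (Complex.differentiableOn_dslope Filter.univ_mem).2
    Complex.differentiable_exp.differentiableOn

lemma sub_mul_dslope_cexp (c ζ : ℂ) :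
    (ζ - c) * dslope Complex.exp c ζ = Complex.exp ζ - Complex.exp c := by
  simpa using sub_smul_dslope Complex.exp c ζ

lemma dslope_cexp_neg (c ζ : ℂ) :
    dslope Complex.exp c (-ζ) = Complex.exp (c - ζ) * dslope Complex.exp (-c) ζ := by
  rcases eq_or_ne ζ (-c) with rfl | hne
  · simp [dslope_same, ← Complex.exp_add]
  · have h1 : -ζ ≠ c := fun h => hne (by rw [← h, neg_neg])
    have h2 : -ζ - c ≠ 0 := sub_ne_zero.2 h1
    have h3 : ζ - -c ≠ 0 := sub_ne_zero.2 hne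
    have h4 : Complex.exp (c - ζ) * (Complex.exp ζ - Complex.exp (-c)) =
        Complex.exp c - Complex.exp (-ζ) := by
      rw [mul_sub, ← Complex.exp_add, ← Complex.exp_add]
      ring_nf
    rw [dslope_of_ne _ h1, dslope_of_ne _ hne, slope_def_field, slope_def_field,
      ← mul_div_assoc, div_eq_div_iff h2 h3, h4]
    ring

lemma cexp_pi_div_two_mul_I : Complex.exp ((π / 2 : ℂ) * Complex.I) = Complex.I :=
  Complex.exp_pi_div_two_mul_I

lemma cexp_neg_pi_div_two_mul_I : Complex.exp (-((π / 2 : ℂ) * Complex.I)) = -Complex.I := by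
  rw [Complex.exp_neg, cexp_pi_div_two_mul_I, Complex.inv_I]

/-- The open strip of half-width `3π/2`. -/
def etaStrip : Set ℂ := {ζ | |ζ.im| < 3 * π / 2}

/-- The closed strip of half-width `π`. -/
def piStrip : Set ℂ := {ζ | |ζ.im| ≤ π}

lemma piStrip_subset_etaStrip : piStrip ⊆ etaStrip := fun ζ (h : |ζ.im| ≤ π) =>
  show |ζ.im| < 3 * π / 2 by linarith [Real.pi_pos]

lemma isOpen_etaStrip : IsOpen etaStrip :=
  isOpen_lt (continuous_abs.comp Complex.continuous_im) continuous_const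

lemma convex_setOf_abs_im (p : ℝ → Prop) (hp : Convex ℝ {y | p |y|}) :
    Convex ℝ {ζ : ℂ | p |ζ.im|} :=
  hp.linear_preimage Complex.imLm

lemma convex_etaStrip : Convex ℝ etaStrip :=
  convex_setOf_abs_im (· < 3 * π / 2) (by
    have : {y : ℝ | |y| < 3 * π / 2} = Ioo (-(3 * π / 2)) (3 * π / 2) := by ext; simp [abs_lt]
    rw [this]; exact convex_Ioo _ _)

lemma convex_piStrip : Convex ℝ piStrip :=
  convex_setOf_abs_im (· ≤ π) (by
    have : {y : ℝ | |y| ≤ π} = Icc (-π) π := by ext; simp [abs_le]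
    rw [this]; exact convex_Icc _ _)

lemma ofReal_mem_etaStrip (x : ℝ) : (x : ℂ) ∈ etaStrip := by
  simp [etaStrip, Real.pi_pos]

lemma neg_mem_etaStrip {ζ : ℂ} (h : ζ ∈ etaStrip) : -ζ ∈ etaStrip := by
  simpa [etaStrip] using h

lemma neg_mem_piStrip {ζ : ℂ} (h : ζ ∈ piStrip) : -ζ ∈ piStrip := by
  simpa [piStrip] using h

/-- The holomorphic extension of the derivative of `x ↦ etaF (exp x)`. -/
noncomputable def etaKernel (ζ : ℂ) : ℂ :=
  1 / 2 - ((dslope Complex.exp ((π / 2 : ℂ) * Complex.I) ζ)⁻¹ +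
    (dslope Complex.exp (-((π / 2 : ℂ) * Complex.I)) ζ)⁻¹) / (2 * π)

lemma dslope_cexp_ne_zero_of_mem_etaStrip {ζ : ℂ} (h : ζ ∈ etaStrip) :
    dslope Complex.exp ((π / 2 : ℂ) * Complex.I) ζ ≠ 0 ∧
      dslope Complex.exp (-((π / 2 : ℂ) * Complex.I)) ζ ≠ 0 := by
  have h' : |ζ.im| < 3 * π / 2 := h
  have h2 := abs_lt.1 h'
  constructor <;> apply dslope_cexp_ne_zero <;> simp <;> rw [abs_lt] <;> constructor <;>
    linarith [h2.1, h2.2, Real.pi_pos]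

lemma differentiableOn_etaKernel : DifferentiableOn ℂ etaKernel etaStrip := by
  unfold etaKernel
  refine (differentiableOn_const _).sub (DifferentiableOn.div_const (.add ?_ ?_) _)
  · exact (differentiable_dslope_cexp _).differentiableOn.inv
      fun ζ h => (dslope_cexp_ne_zero_of_mem_etaStrip h).1
  · exact (differentiable_dslope_cexp _).differentiableOn.inv
      fun ζ h => (dslope_cexp_ne_zero_of_mem_etaStrip h).2

lemma etaKernel_eq {ζ : ℂ} (h : ζ ∈ etaStrip) (h1 : Complex.exp ζ ^ 2 + 1 ≠ 0) :
    etaKernel ζ = Complex.exp ζ * (π / 2 * Complex.exp ζ - ζ) / (π * (Complex.exp ζ ^ 2 + 1)) := by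
  obtain ⟨ha, hb⟩ := dslope_cexp_ne_zero_of_mem_etaStrip h
  have ea := sub_mul_dslope_cexp ((π / 2 : ℂ) * Complex.I) ζ
  have eb := sub_mul_dslope_cexp (-((π / 2 : ℂ) * Complex.I)) ζ
  rw [cexp_pi_div_two_mul_I] at ea
  rw [cexp_neg_pi_div_two_mul_I] at eb
  unfold etaKernel
  set A := dslope Complex.exp ((π / 2 : ℂ) * Complex.I) ζ
  set B := dslope Complex.exp (-((π / 2 : ℂ) * Complex.I)) ζ
  set z := Complex.exp ζ
  have hI := Complex.I_sq
  have hfac : (z - Complex.I) * (z - -Complex.I) = z ^ 2 + 1 := by linear_combination -hI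
  have hz1 : z - Complex.I ≠ 0 := fun h0 => h1 (by rw [← hfac, h0, zero_mul])
  have hz2 : z - -Complex.I ≠ 0 := fun h0 => h1 (by rw [← hfac, h0, mul_zero])
  have hA : A⁻¹ = (ζ - (π / 2 : ℂ) * Complex.I) / (z - Complex.I) := by
    rw [eq_div_iff hz1, ← ea]; field_simp
  have hB : B⁻¹ = (ζ - -((π / 2 : ℂ) * Complex.I)) / (z - -Complex.I) := by
    rw [eq_div_iff hz2, ← eb]; field_simp
  have hpi : (π : ℂ) ≠ 0 := by exact_mod_cast Real.pi_ne_zero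
  rw [hA, hB, div_add_div _ _ hz1 hz2, hfac]
  field_simp
  linear_combination (2 * π : ℂ) * hI

lemma etaKernel_neg_add {ζ : ℂ} (h : ζ ∈ etaStrip) :
    etaKernel (-ζ) + etaKernel ζ = 1 / 2 := by
  obtain ⟨ha, hb⟩ := dslope_cexp_ne_zero_of_mem_etaStrip h
  have ea := sub_mul_dslope_cexp ((π / 2 : ℂ) * Complex.I) ζ
  have eb := sub_mul_dslope_cexp (-((π / 2 : ℂ) * Complex.I)) ζ
  rw [cexp_pi_div_two_mul_I] at ea
  rw [cexp_neg_pi_div_two_mul_I] at eb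
  unfold etaKernel
  rw [dslope_cexp_neg, dslope_cexp_neg, neg_neg, Complex.exp_sub, Complex.exp_sub,
    cexp_pi_div_two_mul_I, cexp_neg_pi_div_two_mul_I]
  set A := dslope Complex.exp ((π / 2 : ℂ) * Complex.I) ζ
  set B := dslope Complex.exp (-((π / 2 : ℂ) * Complex.I)) ζ
  have hz : Complex.exp ζ ≠ 0 := Complex.exp_ne_zero ζ
  set z := Complex.exp ζ
  have hI := Complex.I_sq
  have hpi : (π : ℂ) ≠ 0 := by exact_mod_cast Real.pi_ne_zero
  have hA : (Complex.I / z * B)⁻¹ = -Complex.I * (ζ + (π / 2 : ℂ) * Complex.I) - B⁻¹ := by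
    rw [mul_inv, inv_div, div_eq_mul_inv, Complex.inv_I]
    field_simp
    linear_combination 2 * Complex.I * eb + 2 * hI
  have hB : (-Complex.I / z * A)⁻¹ = Complex.I * (ζ - (π / 2 : ℂ) * Complex.I) - A⁻¹ := by
    rw [mul_inv, inv_div, div_eq_mul_inv, inv_neg, Complex.inv_I]
    field_simp
    linear_combination -2 * Complex.I * ea + 2 * hI
  rw [hA, hB]
  field_simp
  linear_combination (2 * π * A * B : ℂ) * hI

/-- The end `re ζ → -∞` of the strip `piStrip`. -/
def leftEnd : Filter ℂ := Filter.comap Complex.re Filter.atBot ⊓ Filter.principal piStrip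

/-- The end `re ζ → +∞` of the strip `piStrip`. -/
def rightEnd : Filter ℂ := Filter.comap Complex.re Filter.atTop ⊓ Filter.principal piStrip

open Filter Topology in
lemma tendsto_re_leftEnd : Tendsto Complex.re leftEnd atBot :=
  tendsto_comap.mono_left inf_le_left

open Filter Topology in
lemma tendsto_neg_rightEnd : Tendsto (fun ζ : ℂ => -ζ) rightEnd leftEnd := by
  refine tendsto_inf.2 ⟨?_, ?_⟩
  · refine tendsto_comap_iff.2 ?_
    exact tendsto_neg_atTop_atBot.comp (tendsto_comap.mono_left inf_le_left)
  · exact (tendsto_principal_principal.2 fun ζ => neg_mem_piStrip).mono_left inf_le_right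

open Filter Topology in
lemma tendsto_add_mul_I_leftEnd {y : ℝ} (hy : |y| ≤ π) :
    Tendsto (fun x : ℝ => (x : ℂ) + y * Complex.I) atBot leftEnd := by
  refine tendsto_inf.2 ⟨tendsto_comap_iff.2 ?_, tendsto_principal.2 ?_⟩
  · simpa [Function.comp_def] using! tendsto_id
  · exact Eventually.of_forall fun x => by simpa [piStrip] using hy

open Filter Topology in
lemma tendsto_add_mul_I_rightEnd {y : ℝ} (hy : |y| ≤ π) :
    Tendsto (fun x : ℝ => (x : ℂ) + y * Complex.I) atTop rightEnd := by
  refine tendsto_inf.2 ⟨tendsto_comap_iff.2 ?_, tendsto_principal.2 ?_⟩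
  · simpa [Function.comp_def] using! tendsto_id
  · exact Eventually.of_forall fun x => by simpa [piStrip] using hy

open Filter Topology in
lemma tendsto_cexp_leftEnd : Tendsto Complex.exp leftEnd (𝓝 0) := by
  rw [tendsto_zero_iff_norm_tendsto_zero]
  simpa only [Complex.norm_exp] using! Real.tendsto_exp_atBot.comp tendsto_re_leftEnd

open Filter Topology in
lemma tendsto_cexp_mul_self_leftEnd :
    Tendsto (fun ζ : ℂ => Complex.exp ζ * ζ) leftEnd (𝓝 0) := by
  have h1 : Tendsto (fun y : ℝ => y ^ 1 * Real.exp (-y) + π * Real.exp (-y)) atTop (𝓝 0) := by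
    simpa using (Real.tendsto_pow_mul_exp_neg_atTop_nhds_zero 1).add
      ((Real.tendsto_exp_atBot.comp tendsto_neg_atTop_atBot).const_mul π)
  have h2 := h1.comp (tendsto_neg_atBot_atTop.comp tendsto_re_leftEnd)
  refine squeeze_zero_norm' ?_ h2
  have hT : ∀ᶠ ζ in leftEnd, ζ ∈ piStrip := mem_inf_of_right (mem_principal_self _)
  filter_upwards [hT, tendsto_re_leftEnd.eventually (eventually_le_atBot 0)] with ζ hζ hre
  have h3 : ‖ζ‖ ≤ -ζ.re + π := by
    have := Complex.norm_le_abs_re_add_abs_im ζ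
    rw [abs_of_nonpos hre] at this
    have h4 : |ζ.im| ≤ π := hζ
    linarith
  rw [norm_mul, Complex.norm_exp]
  simp only [Function.comp_apply, neg_neg, pow_one]
  nlinarith [mul_le_mul_of_nonneg_left h3 (Real.exp_pos ζ.re).le]

open Filter Topology in
lemma tendsto_etaKernel_leftEnd : Tendsto etaKernel leftEnd (𝓝 0) := by
  have hden : Tendsto (fun ζ : ℂ => Complex.exp ζ ^ 2 + 1) leftEnd (𝓝 1) := by
    simpa using (tendsto_cexp_leftEnd.pow 2).add_const 1
  have hnum : Tendsto (fun ζ : ℂ => Complex.exp ζ * (π / 2 * Complex.exp ζ - ζ)) leftEnd (𝓝 0) := by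
    have := ((tendsto_cexp_leftEnd.mul tendsto_cexp_leftEnd).const_mul (π / 2 : ℂ)).sub
      tendsto_cexp_mul_self_leftEnd
    simp only [mul_zero, sub_zero] at this
    refine this.congr fun ζ => by ring
  have h := hnum.div (hden.const_mul (π : ℂ)) (by simp)
  rw [zero_div] at h
  refine h.congr' ?_
  have hT : ∀ᶠ ζ in leftEnd, ζ ∈ piStrip := mem_inf_of_right (mem_principal_self _)
  filter_upwards [hT, hden.eventually_ne one_ne_zero] with ζ hζ h1
  exact (etaKernel_eq (piStrip_subset_etaStrip hζ) h1).symm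

lemma intervalIntegrable_log_div (a b : ℝ) :
    IntervalIntegrable (fun s : ℝ => Real.log |s| / (1 + s ^ 2)) volume a b := by
  simp only [Real.log_abs, div_eq_mul_inv]
  refine intervalIntegral.intervalIntegrable_log'.mul_continuousOn (Continuous.continuousOn ?_)
  exact Continuous.inv₀ (by fun_prop) fun s => by positivity

lemma hasDerivAt_etaF {t : ℝ} (ht : 0 < t) :
    HasDerivAt etaF ((π / 2 * t - Real.log t) / (π * (t ^ 2 + 1))) t := by
  have h0 : (1 + t ^ 2 : ℝ) ≠ 0 := by positivity
  have hc : ContinuousAt (fun s : ℝ => Real.log |s| / (1 + s ^ 2)) t := by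
    simp only [Real.log_abs]
    exact (Real.continuousAt_log ht.ne').div (by fun_prop) h0
  have hm : StronglyMeasurableAtFilter (fun s : ℝ => Real.log |s| / (1 + s ^ 2)) (nhds t) := by
    refine StronglyMeasurable.stronglyMeasurableAtFilter (Measurable.stronglyMeasurable ?_)
    fun_prop
  have h1 := intervalIntegral.integral_hasDerivAt_right (intervalIntegrable_log_div 0 t) hm hc
  have h2 : HasDerivAt (fun t : ℝ => Real.log (1 + t ^ 2) / 4) (2 * t / (1 + t ^ 2) / 4) t := by
    have : HasDerivAt (fun t : ℝ => 1 + t ^ 2) (2 * t) t := by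
      simpa using (hasDerivAt_pow 2 t).const_add 1
    exact (this.log h0).div_const 4
  refine (h2.sub (h1.const_mul (1 / π))).congr_deriv ?_
  rw [abs_of_pos ht]
  have := Real.pi_ne_zero
  have h3 : t ^ 2 + 1 ≠ 0 := by positivity
  field_simp
  ring

lemma continuous_etaF : Continuous etaF := by
  have h1 : Continuous fun t : ℝ => ∫ s in (0 : ℝ)..t, Real.log |s| / (1 + s ^ 2) :=
    intervalIntegral.continuous_primitive intervalIntegrable_log_div 0
  have h2 : Continuous fun t : ℝ => Real.log (1 + t ^ 2) :=
    Continuous.log (by fun_prop) fun t => by positivity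
  exact (h2.div_const 4).sub (continuous_const.mul h1)

lemma etaF_zero : etaF 0 = 0 := by simp [etaF]

open Filter Topology in
lemma tendsto_etaF_exp_atBot : Tendsto (fun x : ℝ => etaF (Real.exp x)) atBot (𝓝 0) := by
  have := continuous_etaF.tendsto 0
  rw [etaF_zero] at this
  exact this.comp Real.tendsto_exp_atBot

lemma hasDerivAt_etaF_exp (x : ℝ) :
    HasDerivAt (fun x : ℝ => etaF (Real.exp x))
      (Real.exp x * (π / 2 * Real.exp x - x) / (π * (Real.exp x ^ 2 + 1))) x := by
  refine ((hasDerivAt_etaF (Real.exp_pos x)).comp x (Real.hasDerivAt_exp x)).congr_deriv ?_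
  rw [Real.log_exp]
  ring

lemma hasDerivAt_ofReal_etaF_exp (x : ℝ) :
    HasDerivAt (fun x : ℝ => (etaF (Real.exp x) : ℂ)) (etaKernel x) x := by
  refine (hasDerivAt_etaF_exp x).ofReal_comp.congr_deriv ?_
  rw [etaKernel_eq (ofReal_mem_etaStrip x)]
  · push_cast; ring
  · have : Real.exp x ^ 2 + 1 ≠ 0 := by positivity
    exact_mod_cast this

open Filter Topology in
/-- The holomorphic extension of `x ↦ etaF (exp x)` to the strip `etaStrip`. -/
lemma exists_primitive_etaKernel : ∃ E : ℂ → ℂ, (∀ ζ ∈ etaStrip, HasDerivAt E (etaKernel ζ) ζ) ∧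
    (∀ x : ℝ, E x = etaF (Real.exp x)) ∧ (∀ ζ ∈ etaStrip, E ζ = ζ / 2 + E (-ζ)) ∧
    Tendsto E leftEnd (𝓝 0) := by
  obtain ⟨G, hG⟩ := convex_etaStrip.exists_forall_hasDerivWithinAt differentiableOn_etaKernel
  have hexact : Complex.IsExactOn etaKernel etaStrip :=
    ⟨G, fun ζ hζ => (hG ζ hζ).hasDerivAt (isOpen_etaStrip.mem_nhds hζ)⟩
  obtain ⟨E, hE0, hE⟩ := hexact.with_val_at 0 (etaF 1)
  have hreal : ∀ x : ℝ, E x = etaF (Real.exp x) := by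
    have hd : ∀ x : ℝ, HasDerivAt (fun x : ℝ => E x - etaF (Real.exp x)) 0 x := fun x => by
      simpa using! (hE x (ofReal_mem_etaStrip x)).comp_ofReal.sub (hasDerivAt_ofReal_etaF_exp x)
    intro x
    have := is_const_of_deriv_eq_zero (fun x => (hd x).differentiableAt) (fun x => (hd x).deriv) x 0
    simpa [hE0, sub_eq_zero] using this
  refine ⟨E, hE, hreal, fun ζ hζ => ?_, ?_⟩
  · have hd : ∀ ξ ∈ etaStrip, HasDerivWithinAt (fun ξ => E ξ - (ξ / 2 + E (-ξ))) 0 etaStrip ξ := by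
      intro ξ hξ
      have h1 := (hE (-ξ) (neg_mem_etaStrip hξ)).comp ξ (hasDerivAt_neg ξ)
      refine (((hE ξ hξ).sub (((hasDerivAt_id ξ).div_const 2).add h1)).congr_deriv
        ?_).hasDerivWithinAt
      linear_combination etaKernel_neg_add hξ
    have h0 : (0 : ℂ) ∈ etaStrip := by simpa using ofReal_mem_etaStrip 0
    have := convex_etaStrip.norm_image_sub_le_of_norm_hasDerivWithin_le (C := 0) hd (by simp) h0 hζ
    simpa [sub_eq_zero] using this
  · have hreal0 : Tendsto (fun ζ : ℂ => E (ζ.re : ℂ)) leftEnd (𝓝 0) := by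
      simp only [hreal]
      have := (Complex.continuous_ofReal.tendsto 0).comp
        (tendsto_etaF_exp_atBot.comp tendsto_re_leftEnd)
      simpa [Function.comp_def] using this
    have hdiff : Tendsto (fun ζ : ℂ => E ζ - E (ζ.re : ℂ)) leftEnd (𝓝 0) := by
      rw [Metric.tendsto_nhds]
      intro ε hε
      have hk : ∀ᶠ ζ in leftEnd, ‖etaKernel ζ‖ < ε / (2 * π) := by
        simpa using Metric.tendsto_nhds.1 tendsto_etaKernel_leftEnd (ε / (2 * π))
          (by have := Real.pi_pos; positivity)
      rw [leftEnd, eventually_inf_principal, eventually_comap, eventually_atBot] at hk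
      obtain ⟨X, hX⟩ := hk
      have hT : ∀ᶠ ζ in leftEnd, ζ ∈ piStrip := mem_inf_of_right (mem_principal_self _)
      filter_upwards [hT, tendsto_re_leftEnd.eventually (eventually_le_atBot X)] with ζ hζ hre
      have hconv : Convex ℝ ({ζ : ℂ | ζ.re ≤ X} ∩ piStrip) :=
        (convex_halfSpace_re_le X).inter convex_piStrip
      have hb := hconv.norm_image_sub_le_of_norm_hasDerivWithin_le (C := ε / (2 * π))
        (fun ξ hξ => (hE ξ (piStrip_subset_etaStrip hξ.2)).hasDerivWithinAt)
        (fun ξ hξ => (hX ξ.re hξ.1 ξ rfl hξ.2).le)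
        (show (ζ.re : ℂ) ∈ _ from ⟨by simpa using hre, by simp [piStrip, Real.pi_pos.le]⟩)
        (show ζ ∈ _ from ⟨hre, hζ⟩)
      have hn : ‖ζ - ζ.re‖ ≤ π := by
        refine (Complex.norm_le_abs_re_add_abs_im _).trans ?_
        simpa using (show |ζ.im| ≤ π from hζ)
      rw [dist_zero_right]
      refine hb.trans_lt ((mul_le_mul_of_nonneg_left hn
        (by have := Real.pi_pos; positivity)).trans_lt ?_)
      have := Real.pi_ne_zero
      field_simp
      linarith
    simpa using hdiff.add hreal0

open Filter Topology in
/-- The function `exp (-etaF)`, in the logarithmic coordinate, on the strip `etaStrip`, with its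
boundary values on the lines `im ζ = ±π`. -/
lemma exists_extension_exp_neg_etaF : ∃ Φ : ℂ → ℂ, DifferentiableOn ℂ Φ etaStrip ∧
    (∀ x : ℝ, Φ x = Real.exp (-etaF (Real.exp x))) ∧
    (∀ ε : ℝ, ε ^ 2 = 1 → ∀ x : ℝ, Φ (x + (ε * π : ℝ) * Complex.I) =
      Real.exp (etaF (Real.exp x)) * (1 - ε * Complex.I * Real.exp x) / (1 + Real.exp x ^ 2)) ∧
    Tendsto Φ leftEnd (𝓝 1) ∧ Tendsto Φ rightEnd (𝓝 0) := by
  obtain ⟨E, hE, hreal, hrefl, hleft⟩ := exists_primitive_etaKernel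
  refine ⟨fun ζ => Complex.exp (-E ζ), ?_, ?_, ?_, ?_, ?_⟩
  · exact fun ζ hζ => (hE ζ hζ).differentiableAt.neg.cexp.differentiableWithinAt
  · intro x
    simp [hreal]
  · intro ε hε x
    have hI := Complex.I_sq
    have hεC : (ε : ℂ) ^ 2 = 1 := by exact_mod_cast hε
    have hε1 : ε = 1 ∨ ε = -1 := sq_eq_sq_iff_eq_or_eq_neg.1 (by rw [hε, one_pow])
    have habs : |ε * π| ≤ π := by
      rcases hε1 with rfl | rfl <;> simp [abs_of_pos Real.pi_pos]
    have hexp : ∀ x : ℝ, Complex.exp (x + (ε * π : ℝ) * Complex.I) = -(Real.exp x : ℂ) := by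
      intro x
      rw [Complex.exp_add]
      rcases hε1 with rfl | rfl <;> simp [Complex.exp_neg]
    have hne : ∀ x : ℝ, (Real.exp x : ℂ) ^ 2 + 1 ≠ 0 := fun x => by
      have : Real.exp x ^ 2 + 1 ≠ 0 := by positivity
      exact_mod_cast this
    have hmem : ∀ x : ℝ, (x + (ε * π : ℝ) * Complex.I : ℂ) ∈ piStrip := fun x => by
      simpa [piStrip] using habs
    set D : ℝ → ℂ := fun x => Complex.exp (-E (x + (ε * π : ℝ) * Complex.I) -
      etaF (Real.exp x)) * (1 + ε * Complex.I * Real.exp x) with hD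
    have hd : ∀ x, HasDerivAt D 0 x := by
      intro x
      have h1 : HasDerivAt (fun x : ℝ => E (x + (ε * π : ℝ) * Complex.I))
          (etaKernel (x + (ε * π : ℝ) * Complex.I)) x := by
        have h := (hE _ (piStrip_subset_etaStrip (hmem x))).comp_add_const
          (x : ℂ) ((ε * π : ℝ) * Complex.I)
        exact h.comp_ofReal
      have h2 : HasDerivAt (fun x : ℝ => (1 + ε * Complex.I * Real.exp x : ℂ))
          (ε * Complex.I * Real.exp x) x :=
        (((Real.hasDerivAt_exp x).ofReal_comp).const_mul _).const_add 1
      refine (((h1.neg.sub (hasDerivAt_ofReal_etaF_exp x)).cexp).mul h2).congr_deriv ?_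
      have hpi : (π : ℂ) ≠ 0 := by exact_mod_cast Real.pi_ne_zero
      rw [etaKernel_eq (piStrip_subset_etaStrip (hmem x)) (by rw [hexp, neg_sq]; exact hne x), hexp,
        etaKernel_eq (ofReal_mem_etaStrip x) (by simpa using hne x), neg_sq,
        mul_assoc, ← mul_add, ← Complex.ofReal_exp]
      refine mul_eq_zero_of_right _ ?_
      have := hne x
      push_cast
      push_cast at this
      field_simp
      linear_combination (-2 * π * Complex.exp x ^ 2 : ℂ) * (Complex.I ^ 2 * hεC + hI)
    have hlim : Tendsto D atBot (𝓝 1) := by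
      have h1 := (hleft.comp (tendsto_add_mul_I_leftEnd habs)).neg.sub
        ((Complex.continuous_ofReal.tendsto 0).comp tendsto_etaF_exp_atBot)
      have h2 : Tendsto (fun x : ℝ => (1 + ε * Complex.I * Real.exp x : ℂ)) atBot (𝓝 1) := by
        simpa using! (((Complex.continuous_ofReal.tendsto 0).comp
          Real.tendsto_exp_atBot).const_mul (ε * Complex.I)).const_add (1 : ℂ)
      rw [hD]
      simpa using! h1.cexp.mul h2
    have hconst : D x = 1 := by
      refine tendsto_nhds_unique (tendsto_const_nhds (f := atBot (α := ℝ))) (hlim.congr fun y => ?_)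
      exact is_const_of_deriv_eq_zero (fun x => (hd x).differentiableAt) (fun x => (hd x).deriv) y x
    have hne' := hne x
    rw [add_comm] at hne'
    rw [hD] at hconst
    simp only [sub_eq_add_neg, Complex.exp_add] at hconst
    rw [eq_div_iff hne', Complex.ofReal_exp]
    have hee : Complex.exp (etaF (Real.exp x)) * Complex.exp (-(etaF (Real.exp x))) = 1 := by
      rw [← Complex.exp_add]; simp
    simp only [Complex.ofReal_exp] at hconst hee ⊢
    linear_combination Complex.exp (etaF (Real.exp x)) * (1 - ε * Complex.I * Complex.exp x) * hconst
      - Complex.exp (-E (x + (ε * π : ℝ) * Complex.I)) *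
        (1 - ε ^ 2 * Complex.I ^ 2 * Complex.exp x ^ 2) * hee
      + Complex.exp (-E (x + (ε * π : ℝ) * Complex.I)) * Complex.exp x ^ 2 *
        (Complex.I ^ 2 * hεC + hI)
  · simpa using! hleft.neg.cexp
  · have h1 : Tendsto (fun ζ : ℂ => Complex.exp (-ζ)) rightEnd (𝓝 0) :=
      tendsto_cexp_leftEnd.comp tendsto_neg_rightEnd
    have h2 : Tendsto (fun ζ : ℂ => Complex.exp (-ζ / 2)) rightEnd (𝓝 0) := by
      rw [tendsto_zero_iff_norm_tendsto_zero] at h1 ⊢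
      have h3 := (Real.continuous_sqrt.tendsto 0).comp h1
      rw [Real.sqrt_zero] at h3
      refine h3.congr fun ζ => ?_
      simp only [Function.comp_apply, Complex.norm_exp]
      rw [← Real.exp_half]
      simp
    have h4 := h2.mul (hleft.comp tendsto_neg_rightEnd).neg.cexp
    rw [zero_mul] at h4
    refine h4.congr' ?_
    have hT : ∀ᶠ ζ in rightEnd, ζ ∈ piStrip := mem_inf_of_right (mem_principal_self _)
    filter_upwards [hT] with ζ hζ
    rw [hrefl ζ (piStrip_subset_etaStrip hζ), ← Complex.exp_add]
    congr 1
    simp only [Function.comp_apply]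
    ring

lemma continuous_comp_ofReal_add_mul_I {K : ℂ → ℂ} (hK : DifferentiableOn ℂ K etaStrip) {y : ℝ}
    (hy : |y| ≤ π) : Continuous fun x : ℝ => K (x + y * Complex.I) :=
  hK.continuousOn.comp_continuous (by fun_prop) fun x =>
    piStrip_subset_etaStrip (by simpa [piStrip] using hy)

open Filter Topology in
lemma tendsto_integral_vertical {K : ℂ → ℂ} (hK : DifferentiableOn ℂ K etaStrip) {F : Filter ℂ}
    {l : Filter ℝ} [l.IsCountablyGenerated] {c : ℂ} (hlim : Tendsto K F (𝓝 c))
    (hF : F = comap Complex.re l ⊓ 𝓟 piStrip) :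
    Tendsto (fun x : ℝ => ∫ y in -π..π, K (x + y * Complex.I)) l (𝓝 (2 * π * c)) := by
  have hmem : ∀ x : ℝ, ∀ y ∈ uIoc (-π) π, (x + y * Complex.I : ℂ) ∈ piStrip := by
    intro x y hy
    rw [uIoc_of_le (by linarith [Real.pi_pos])] at hy
    simpa [piStrip, abs_le] using ⟨hy.1.le, hy.2⟩
  have hval : ∫ _ in -π..π, c = 2 * π * c := by
    rw [intervalIntegral.integral_const, Complex.real_smul]
    push_cast
    ring
  rw [← hval]
  refine intervalIntegral.tendsto_integral_filter_of_dominated_convergence (fun _ => ‖c‖ + 1)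
    (Eventually.of_forall fun x => ?_) ?_ (by simp) (Eventually.of_forall fun y hy => ?_)
  · refine ContinuousOn.aestronglyMeasurable (hK.continuousOn.comp (by fun_prop) fun y hy =>
      piStrip_subset_etaStrip (hmem x y hy)) measurableSet_uIoc
  · have h1 : ∀ᶠ ζ in F, ‖K ζ‖ < ‖c‖ + 1 := hlim.norm.eventually_lt_const (lt_add_one _)
    rw [hF, eventually_inf_principal, eventually_comap] at h1
    filter_upwards [h1] with x hx
    exact Eventually.of_forall fun y hy => (hx _ (by simp) (hmem x y hy)).le
  · refine hlim.comp ?_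
    rw [hF]
    refine tendsto_inf.2 ⟨tendsto_comap_iff.2 ?_, tendsto_principal.2 ?_⟩
    · simpa [Function.comp_def] using! tendsto_id
    · exact Eventually.of_forall fun x => hmem x y hy

open Filter Topology in
/-- Contour integration along the boundary of the strip `piStrip`. -/
lemma integral_eq_of_boundary_jump {K : ℂ → ℂ} (hK : DifferentiableOn ℂ K etaStrip) {a b : ℂ}
    (ha : Tendsto K leftEnd (𝓝 a)) (hb : Tendsto K rightEnd (𝓝 b)) {g : ℝ → ℝ}
    (hg0 : ∀ x, 0 ≤ g x)
    (hg : ∀ x : ℝ, K (x + (-π : ℝ) * Complex.I) - K (x + π * Complex.I) =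
      2 * π * Complex.I * g x) :
    ((∫ x, g x : ℝ) : ℂ) = a - b := by
  have hpi : (π : ℂ) ≠ 0 := by exact_mod_cast Real.pi_ne_zero
  have hI := Complex.I_ne_zero
  have hc1 := continuous_comp_ofReal_add_mul_I hK (y := -π)
    (by rw [abs_neg, abs_of_pos Real.pi_pos])
  have hc2 := continuous_comp_ofReal_add_mul_I hK (y := π)
    (abs_of_pos Real.pi_pos).le
  have hgc : Continuous g := by
    have : g = fun x : ℝ => ((K (x + (-π : ℝ) * Complex.I) - K (x + π * Complex.I)) /
        (2 * π * Complex.I)).re := by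
      funext x
      rw [hg, mul_div_cancel_left₀ _ (by simp [hpi]), Complex.ofReal_re]
    rw [this]
    exact Complex.continuous_re.comp ((hc1.sub hc2).div_const _)
  have hrect : ∀ R : ℝ, ((∫ x in -R..R, g x : ℝ) : ℂ) =
      ((∫ y in -π..π, K ((-R : ℝ) + y * Complex.I)) - ∫ y in -π..π, K (R + y * Complex.I)) /
        (2 * π) := by
    intro R
    have h := Complex.integral_boundary_rect_eq_zero_of_differentiableOn K
      ((-R : ℝ) + (-π : ℝ) * Complex.I) (R + π * Complex.I) (hK.mono fun ζ hζ => by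
        have h2 : ζ.im ∈ uIcc (-π) π := by simpa using hζ.2
        rw [uIcc_of_le (by linarith [Real.pi_pos])] at h2
        exact piStrip_subset_etaStrip (abs_le.2 h2))
    simp only [Complex.add_re, Complex.ofReal_re, Complex.re_ofReal_mul, Complex.I_re, mul_zero,
      add_zero, Complex.add_im, Complex.ofReal_im, Complex.im_ofReal_mul, Complex.I_im, mul_one,
      zero_add, smul_eq_mul] at h
    rw [← intervalIntegral.integral_sub (hc1.intervalIntegrable _ _) (hc2.intervalIntegrable _ _)]
      at h
    simp only [hg] at h
    rw [intervalIntegral.integral_const_mul, intervalIntegral.integral_ofReal] at h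
    rw [eq_div_iff (by simp [hpi])]
    refine mul_left_cancel₀ hI ?_
    linear_combination h
  have hlim : Tendsto (fun R : ℝ => ((∫ x in -R..R, g x : ℝ) : ℂ)) atTop (𝓝 (a - b)) := by
    have h1 := (tendsto_integral_vertical hK ha rfl).comp tendsto_neg_atTop_atBot
    have h2 := (h1.sub (tendsto_integral_vertical hK hb rfl)).div_const (2 * π : ℂ)
    rw [← mul_sub, mul_div_cancel_left₀ _ (by simp [hpi])] at h2
    exact h2.congr fun R => (hrect R).symm
  have hlimR : Tendsto (fun R : ℝ => ∫ x in -R..R, g x) atTop (𝓝 (a - b).re) := by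
    simpa using! (Complex.continuous_re.tendsto _).comp hlim
  have hint : Integrable g := by
    refine integrable_of_intervalIntegral_norm_tendsto (a - b).re
      (fun R => (hgc.integrableOn_Icc (a := -R) (b := R)).mono_set Ioc_subset_Icc_self)
      tendsto_neg_atTop_atBot tendsto_id ?_
    simpa [abs_of_nonneg (hg0 _)] using! hlimR
  have h1 := intervalIntegral_tendsto_integral hint tendsto_neg_atTop_atBot tendsto_id
  exact tendsto_nhds_unique ((Complex.continuous_ofReal.tendsto _).comp h1) hlim

lemma integral_Ioi_eq_integral_comp_exp (g : ℝ → ℝ) :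
    ∫ u in Ioi (0 : ℝ), g u = ∫ x, Real.exp x * g (Real.exp x) := by
  have h := integral_image_eq_integral_abs_deriv_smul (s := univ) (f := Real.exp) (f' := Real.exp)
    MeasurableSet.univ (fun x _ => (Real.hasDerivAt_exp x).hasDerivWithinAt)
    Real.exp_injective.injOn g
  rw [image_univ, Real.range_exp] at h
  simpa using h

lemma fexit_nonneg {u : ℝ} (hu : 0 < u) : 0 ≤ fexit u := by
  unfold fexit
  have := Real.pi_pos
  positivity

lemma boundary_jump_eq_fexit {Φ : ℂ → ℂ} (hΦ : ∀ ε : ℝ, ε ^ 2 = 1 → ∀ x : ℝ,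
      Φ (x + (ε * π : ℝ) * Complex.I) =
      Real.exp (etaF (Real.exp x)) * (1 - ε * Complex.I * Real.exp x) / (1 + Real.exp x ^ 2))
    (x : ℝ) : Φ (x + (-π : ℝ) * Complex.I) - Φ (x + π * Complex.I) =
      2 * π * Complex.I * fexit (Real.exp x) := by
  have h1 := hΦ (-1) (by norm_num) x
  have h2 := hΦ 1 (by norm_num) x
  rw [neg_one_mul] at h1
  rw [one_mul] at h2
  have hpi : (π : ℂ) ≠ 0 := by exact_mod_cast Real.pi_ne_zero
  rw [h1, h2, fexit]
  push_cast
  field_simp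
  ring

theorem integral_fexit_div :
    (∀ s : ℝ, 0 < s → (∫ u in Ioi (0 : ℝ), fexit u / (s + u)) = Real.exp (-etaF s)) ∧
    (∫ u in Ioi (0 : ℝ), fexit u / u) = 1 := by
  obtain ⟨Φ, hd, hreal, hbd, hleft, hright⟩ := exists_extension_exp_neg_etaF
  have hjump := boundary_jump_eq_fexit hbd
  refine ⟨fun s hs => ?_, ?_⟩
  · rw [integral_Ioi_eq_integral_comp_exp]
    set L : ℂ := (Real.log s : ℂ) with hL
    have hexpL : Complex.exp L = s := by rw [hL, ← Complex.ofReal_exp, Real.exp_log hs]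
    have hΦL : Φ L = Real.exp (-etaF s) := by rw [hL, hreal, Real.exp_log hs]
    have hs0 : (s : ℂ) ≠ 0 := by exact_mod_cast hs.ne'
    have hLmem : L ∈ etaStrip := ofReal_mem_etaStrip _
    set K : ℂ → ℂ := fun ζ => dslope Φ L ζ / dslope Complex.exp L ζ * Complex.exp ζ with hK
    have hKd : DifferentiableOn ℂ K etaStrip := by
      refine (((Complex.differentiableOn_dslope (isOpen_etaStrip.mem_nhds hLmem)).2 hd).div
        (differentiable_dslope_cexp L).differentiableOn fun ζ hζ => ?_).mul
        Complex.differentiable_exp.differentiableOn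
      refine dslope_cexp_ne_zero ?_
      have h : |ζ.im| < 3 * π / 2 := hζ
      simp only [hL, Complex.ofReal_im, sub_zero]
      linarith [Real.pi_pos]
    have hKeq : ∀ ζ, Complex.exp ζ ≠ s →
        K ζ = (Φ ζ - Φ L) * (Complex.exp ζ / (Complex.exp ζ - s)) := by
      intro ζ hζ
      have hne : ζ ≠ L := fun h => hζ (by rw [h, hexpL])
      have h1 : ζ - L ≠ 0 := sub_ne_zero.2 hne
      have h2 : Complex.exp ζ - s ≠ 0 := sub_ne_zero.2 hζ
      simp only [hK]
      rw [dslope_of_ne _ hne, dslope_of_ne _ hne, slope_def_field, slope_def_field, hexpL]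
      field_simp
    have hleftK : Filter.Tendsto K leftEnd (nhds 0) := by
      have h := (hleft.sub_const (Φ L)).mul
        (tendsto_cexp_leftEnd.div (tendsto_cexp_leftEnd.sub_const (s : ℂ)) (by simpa using hs0))
      rw [zero_div, mul_zero] at h
      refine h.congr' ?_
      filter_upwards [tendsto_cexp_leftEnd.eventually_ne hs0.symm] with ζ hζ
      exact (hKeq ζ hζ).symm
    have hrightK : Filter.Tendsto K rightEnd (nhds (-Φ L)) := by
      have h0 : Filter.Tendsto (fun ζ : ℂ => 1 - s * Complex.exp (-ζ)) rightEnd (nhds 1) := by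
        simpa using! ((tendsto_cexp_leftEnd.comp tendsto_neg_rightEnd).const_mul
          (s : ℂ)).const_sub (1 : ℂ)
      have h := (hright.sub_const (Φ L)).mul (h0.inv₀ one_ne_zero)
      rw [inv_one, mul_one, zero_sub] at h
      refine h.congr' ?_
      filter_upwards [h0.eventually_ne one_ne_zero] with ζ hζ
      have hz := Complex.exp_ne_zero ζ
      have hsub : 1 - s * Complex.exp (-ζ) = (Complex.exp ζ - s) / Complex.exp ζ := by
        rw [Complex.exp_neg]
        field_simp
      rw [hsub] at hζ ⊢
      rw [hKeq ζ fun h => hζ (by rw [h, sub_self, zero_div]), inv_div]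
    have hjumpK : ∀ x : ℝ, K (x + (-π : ℝ) * Complex.I) - K (x + π * Complex.I) =
        2 * π * Complex.I * (Real.exp x * (fexit (Real.exp x) / (s + Real.exp x)) : ℝ) := by
      intro x
      have hsum : (Real.exp x : ℂ) + s ≠ 0 := by exact_mod_cast (by positivity : Real.exp x + s ≠ 0)
      have e1 : Complex.exp (x + (-π : ℝ) * Complex.I) = -(Real.exp x : ℂ) := by
        simp [Complex.exp_add, Complex.exp_neg]
      have e2 : Complex.exp (x + π * Complex.I) = -(Real.exp x : ℂ) := by simp [Complex.exp_add]
      have hne : -(Real.exp x : ℂ) ≠ s := fun h => hsum (by rw [← h]; ring)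
      have hquot : -(Real.exp x : ℂ) / (-(Real.exp x : ℂ) - s) = Real.exp x / (s + Real.exp x) := by
        rw [← neg_add', neg_div_neg_eq, add_comm]
      rw [hKeq _ (by rwa [e1]), hKeq _ (by rwa [e2]), e1, e2, hquot, ← sub_mul,
        sub_sub_sub_cancel_right, hjump]
      push_cast
      ring
    have h := integral_eq_of_boundary_jump hKd hleftK hrightK (fun x => mul_nonneg (Real.exp_pos x).le
      (div_nonneg (fexit_nonneg (Real.exp_pos x)) (by positivity))) hjumpK
    rw [zero_sub, neg_neg, hΦL] at h
    exact_mod_cast h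
  · rw [integral_Ioi_eq_integral_comp_exp]
    have h := integral_eq_of_boundary_jump (g := fun x => fexit (Real.exp x)) hd hleft hright
      (fun x => fexit_nonneg (Real.exp_pos x)) hjump
    have h1 : (∫ x, fexit (Real.exp x)) = 1 := by exact_mod_cast h.trans (sub_zero 1)
    rw [← h1]
    congr 1
    funext x
    exact mul_div_cancel₀ _ (Real.exp_pos x).ne'
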